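/- Let p be a prime and a, b, c, d integers with 1 ≤ b ≤ a, c < 0 and d < 0. Then, in ℤ_p, the limit as e → ∞ of S(p^e·a + c, p^e·b + d) equals |s(−d, −c)| times the limit as e → ∞ of S(p^e·a, p^e·b) (both limits exist). -/

import Mathlib

/-- Stirling numbers of the second kind for integer arguments:
`S(n,k) = (1/k!) ∑_{i=0}^{k} (-1)^(k-i) C(k,i) i^n` for `n, k ≥ 0` (with `0^0 = 1`),
and `S(n,k) = 0` if `n < 0` or `k < 0`. -/
def stirling2 (n k : ℤ) : ℤ :=
  if n < 0 ∨ k < 0 then 0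
  else (∑ i ∈ Finset.range (k.toNat + 1),
      (-1 : ℤ) ^ (k.toNat - i) * (Nat.choose k.toNat i : ℤ) * (i : ℤ) ^ n.toNat)
    / (Nat.factorial k.toNat : ℤ)

/-- Unsigned Stirling numbers of the first kind `|s(n,k)|`:
`|s(0,0)| = 1`, `|s(0,k)| = 0` for `k ≠ 0`, `|s(n,k)| = 0` for `k < 0`, and
`|s(n+1,k)| = n·|s(n,k)| + |s(n,k-1)|`. -/
def stirling1Abs : ℕ → ℤ → ℤ
  | 0, k => if k = 0 then 1 else 0
  | n + 1, k => if k < 0 then 0 else (n : ℤ) * stirling1Abs n k + stirling1Abs n (k - 1)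

section

open Finset PowerSeries

/-- The alternating sum `∑ (-1)^(k-i) C(k,i) i^n` equals `k! S(n,k)`. -/
theorem sum_alternating_choose_mul_pow (n k : ℕ) :
    ∑ i ∈ range (k + 1), (-1 : ℤ) ^ (k - i) * (k.choose i : ℤ) * (i : ℤ) ^ n =
      (k.factorial : ℤ) * (Nat.stirlingSecond n k : ℤ) := by
  induction n generalizing k with
  | zero =>
    have h := add_pow (1 : ℤ) (-1) k
    simp only [one_pow, one_mul, add_neg_cancel] at h
    simp only [pow_zero, mul_one]
    rw [← h]
    cases k <;> simp
  | succ n ih =>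
    cases k with
    | zero => simp
    | succ k =>
      have hterm : ∀ i ∈ range (k + 2),
          (-1 : ℤ) ^ (k + 1 - i) * ((k + 1).choose i : ℤ) * (i : ℤ) ^ (n + 1) =
          (k + 1) * ((-1 : ℤ) ^ (k + 1 - i) * ((k + 1).choose i : ℤ) * (i : ℤ) ^ n
            - (-1 : ℤ) ^ (k + 1 - i) * (k.choose i : ℤ) * (i : ℤ) ^ n) := by
        intro i _
        cases i with
        | zero => simp
        | succ i =>
          have h₁ : ((k + 1 : ℕ) : ℤ) * (k.choose i : ℤ) =
              ((k + 1).choose (i + 1) : ℤ) * ((i + 1 : ℕ) : ℤ) := by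
            exact_mod_cast Nat.add_one_mul_choose_eq k i
          have h₂ : ((k + 1).choose (i + 1) : ℤ) = k.choose i + k.choose (i + 1) := by
            exact_mod_cast Nat.choose_succ_succ k i
          rw [Nat.add_sub_add_right]
          push_cast at h₁ ⊢
          linear_combination (-1 : ℤ) ^ (k - i) * ((i : ℤ) + 1) ^ n *
            (-h₁ - (k + 1) * h₂)
      rw [sum_congr rfl hterm, ← mul_sum, sum_sub_distrib, ih (k + 1),
        sum_range_succ (fun i => (-1 : ℤ) ^ (k + 1 - i) * (k.choose i : ℤ) * (i : ℤ) ^ n)]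
      have hsign : ∀ i ∈ range (k + 1),
          (-1 : ℤ) ^ (k + 1 - i) * (k.choose i : ℤ) * (i : ℤ) ^ n =
          -((-1 : ℤ) ^ (k - i) * (k.choose i : ℤ) * (i : ℤ) ^ n) := by
        intro i hi
        rw [Nat.succ_sub (Nat.lt_succ_iff.mp (mem_range.mp hi)), pow_succ]
        ring
      rw [sum_congr rfl hsign, sum_neg_distrib, ih k, Nat.stirlingSecond_succ_succ]
      simp only [Nat.choose_succ_self, Nat.factorial_succ]
      push_cast
      ring

theorem stirling2_natCast (n k : ℕ) : stirling2 n k = Nat.stirlingSecond n k := by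
  have h : ¬ ((n : ℤ) < 0 ∨ (k : ℤ) < 0) := by omega
  rw [stirling2, if_neg h, Int.toNat_natCast, Int.toNat_natCast,
    sum_alternating_choose_mul_pow, Int.mul_ediv_cancel_left _ (by positivity)]

theorem stirling2_eq_add (n k : ℤ) (hn : 1 ≤ n) (hk : 1 ≤ k) :
    stirling2 n k = k * stirling2 (n - 1) k + stirling2 (n - 1) (k - 1) := by
  obtain ⟨n, rfl⟩ : ∃ m : ℕ, n = m + 1 := ⟨(n - 1).toNat, by omega⟩
  obtain ⟨k, rfl⟩ : ∃ m : ℕ, k = m + 1 := ⟨(k - 1).toNat, by omega⟩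
  have h₁ := stirling2_natCast (n + 1) (k + 1)
  have h₂ := stirling2_natCast n (k + 1)
  push_cast at h₁ h₂
  rw [add_sub_cancel_right, add_sub_cancel_right, h₁, h₂, stirling2_natCast,
    Nat.stirlingSecond_succ_succ]
  push_cast
  ring

theorem stirling1Abs_of_neg (n : ℕ) {k : ℤ} (hk : k < 0) : stirling1Abs n k = 0 := by
  cases n with
  | zero => simp [stirling1Abs, hk.ne]
  | succ n => simp [stirling1Abs, hk]

theorem stirling1Abs_succ (n : ℕ) (k : ℤ) :
    stirling1Abs (n + 1) k = n * stirling1Abs n k + stirling1Abs n (k - 1) := by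
  by_cases hk : k < 0
  · rw [stirling1Abs_of_neg _ hk, stirling1Abs_of_neg _ hk, stirling1Abs_of_neg _ (by omega)]
    simp
  · rw [stirling1Abs, if_neg hk]

/-- The power series `∏_{i=1}^k (1 - i X)⁻¹`, generating the numbers `S(m + k, k)`. -/
noncomputable def stirlingSeries (k : ℕ) : ℤ⟦X⟧ :=
  ∏ i ∈ range k, PowerSeries.mk fun n => ((i + 1 : ℕ) : ℤ) ^ n

theorem coeff_stirlingSeries (k m : ℕ) :
    coeff m (stirlingSeries k) = Nat.stirlingSecond (m + k) k := by
  induction k generalizing m with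
  | zero => cases m <;> simp [stirlingSeries, coeff_one]
  | succ k ihk =>
    have hgeom : (PowerSeries.mk fun n => ((k + 1 : ℕ) : ℤ) ^ n) =
        C ((k + 1 : ℕ) : ℤ) * X * (PowerSeries.mk fun n => ((k + 1 : ℕ) : ℤ) ^ n) + 1 := by
      ext n
      rw [mul_assoc]
      cases n with
      | zero => simp
      | succ n => rw [map_add, coeff_C_mul, coeff_succ_X_mul]; simp [coeff_one, pow_succ']
    have hrec : stirlingSeries (k + 1) =
        C ((k + 1 : ℕ) : ℤ) * (X * stirlingSeries (k + 1)) + stirlingSeries k := by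
      rw [stirlingSeries, prod_range_succ, ← stirlingSeries]
      linear_combination stirlingSeries k * hgeom
    induction m with
    | zero =>
      rw [hrec, map_add, ihk]
      simp [Nat.stirlingSecond_self]
    | succ m ihm =>
      rw [hrec, map_add, coeff_C_mul, coeff_succ_X_mul, ihm, ihk,
        show m + 1 + (k + 1) = (m + (k + 1)) + 1 by ring, Nat.stirlingSecond_succ_succ,
        show m + 1 + k = m + (k + 1) by ring]
      push_cast
      ring

theorem natCast_dvd_sub_iff_map_eq (q : ℕ) (A B : ℤ⟦X⟧) :
    (q : ℤ⟦X⟧) ∣ A - B ↔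
      map (Int.castRingHom (ZMod q)) A = map (Int.castRingHom (ZMod q)) B := by
  rw [← sub_eq_zero, ← map_sub]
  constructor
  · rintro ⟨D, hD⟩
    rw [hD, map_mul, map_natCast, ← map_natCast (C (R := ZMod q)), ZMod.natCast_self]
    simp
  · intro h
    have hdvd : ∀ n, (q : ℤ) ∣ coeff n (A - B) := fun n => by
      have := congrArg (coeff n) h
      rw [coeff_map, eq_intCast, map_zero] at this
      exact (ZMod.intCast_zmod_eq_zero_iff_dvd _ q).mp this
    choose D hD using hdvd
    refine ⟨PowerSeries.mk D, ?_⟩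
    ext n
    rw [hD, ← map_natCast (C (R := ℤ)), coeff_C_mul, coeff_mk]

theorem dvd_coeff_of_dvd {p e : ℕ} {A : ℤ⟦X⟧} (h : (p : ℤ⟦X⟧) ^ e ∣ A) (n : ℕ) :
    (p : ℤ) ^ e ∣ coeff n A := by
  obtain ⟨D, rfl⟩ := h
  rw [← map_natCast (C (R := ℤ)), ← map_pow, coeff_C_mul]
  exact dvd_mul_right _ _

theorem dvd_stirlingSeries_mul_sub_pow {q M : ℕ} (h : q ∣ M) (b : ℕ) :
    (q : ℤ⟦X⟧) ∣ stirlingSeries (M * b) - stirlingSeries M ^ b := by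
  rw [natCast_dvd_sub_iff_map_eq, map_pow]
  induction b with
  | zero => simp [stirlingSeries]
  | succ b ih =>
    rw [Nat.mul_succ, stirlingSeries, prod_range_add, map_mul, ← stirlingSeries, ih, pow_succ,
      stirlingSeries]
    congr 1
    rw [map_prod, map_prod]
    refine prod_congr rfl fun i _ => ?_
    have hM : ((M * b : ℕ) : ZMod q) = 0 :=
      (ZMod.natCast_eq_zero_iff _ q).mpr (h.mul_right b)
    ext n
    simp only [coeff_map, coeff_mk, eq_intCast]
    push_cast at hM ⊢
    rw [hM, zero_add]

theorem pow_succ_dvd_pow_sub_pow {R : Type*} [CommRing R] {p e : ℕ} {x y : R}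
    (he : e ≠ 0) (h : (p : R) ^ e ∣ x - y) : (p : R) ^ (e + 1) ∣ x ^ p - y ^ p := by
  rw [← (Commute.all x y).mul_geom_sum₂, pow_succ]
  exact mul_dvd_mul h (dvd_geom_sum₂_self ((dvd_pow_self _ he).trans h))

theorem dvd_stirlingSeries_pow_sub (p e : ℕ) :
    (p : ℤ⟦X⟧) ^ e ∣ stirlingSeries (p ^ (e + 1)) - stirlingSeries p ^ p ^ e := by
  induction e with
  | zero => simp
  | succ e ih =>
    have h₁ : (p : ℤ⟦X⟧) ^ (e + 1) ∣
        stirlingSeries (p ^ (e + 2)) - stirlingSeries (p ^ (e + 1)) ^ p := by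
      have := dvd_stirlingSeries_mul_sub_pow (dvd_refl (p ^ (e + 1))) p
      rwa [← pow_succ, Nat.cast_pow] at this
    have h₂ : (p : ℤ⟦X⟧) ^ (e + 1) ∣
        stirlingSeries (p ^ (e + 1)) ^ p - (stirlingSeries p ^ p ^ e) ^ p := by
      rcases eq_or_ne e 0 with rfl | he
      · simp
      · exact pow_succ_dvd_pow_sub_pow he ih
    rw [pow_succ p e, pow_mul]
    simpa using dvd_add h₁ h₂

theorem dvd_stirlingSeries_pow_mul_sub (p e b : ℕ) :
    (p : ℤ⟦X⟧) ^ e ∣ stirlingSeries (p ^ (e + 1) * b) - (stirlingSeries p ^ b) ^ p ^ e := by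
  have h₁ : (p : ℤ⟦X⟧) ^ e ∣
      stirlingSeries (p ^ (e + 1) * b) - stirlingSeries (p ^ (e + 1)) ^ b := by
    have := dvd_stirlingSeries_mul_sub_pow (pow_dvd_pow p e.le_succ) b
    rwa [Nat.cast_pow] at this
  have h₂ := (dvd_stirlingSeries_pow_sub p e).trans (sub_dvd_pow_sub_pow _ _ b)
  rw [← pow_mul, mul_comm b, pow_mul]
  simpa using dvd_add h₁ h₂

theorem dvd_pow_sub_expand (p : ℕ) [hp : Fact p.Prime] (A : ℤ⟦X⟧) (j : ℕ) :
    (p : ℤ⟦X⟧) ∣ A ^ p ^ j - expand (p ^ j) (pow_ne_zero j hp.out.ne_zero) A := by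
  rw [natCast_dvd_sub_iff_map_eq, map_pow, map_expand]
  have h := MvPowerSeries.map_iterateFrobenius_expand p hp.out.ne_zero
    (f := map (Int.castRingHom (ZMod p)) A) j
  have hF : iterateFrobenius (ZMod p) p j = RingHom.id _ := Subsingleton.elim _ _
  rw [hF, MvPowerSeries.map_id] at h
  exact h.symm

theorem dvd_pow_sub_expand_pow (p : ℕ) [hp : Fact p.Prime] (A : ℤ⟦X⟧) (j e : ℕ) :
    (p : ℤ⟦X⟧) ^ (e + 1) ∣ A ^ p ^ (e + j) -
      expand (p ^ j) (pow_ne_zero j hp.out.ne_zero) (A ^ p ^ e) := by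
  rw [map_pow, add_comm e j, pow_add p, pow_mul]
  exact dvd_sub_pow_of_dvd_sub (dvd_pow_sub_expand p A j) e

theorem dvd_stirlingSeries_sub_expand (p : ℕ) [hp : Fact p.Prime] (b j e : ℕ) :
    (p : ℤ⟦X⟧) ^ e ∣ stirlingSeries (p ^ (e + j + 1) * b) -
      expand (p ^ j) (pow_ne_zero j hp.out.ne_zero) ((stirlingSeries p ^ b) ^ p ^ e) := by
  have h₁ := (pow_dvd_pow (p : ℤ⟦X⟧) (Nat.le_add_right e j)).trans
    (dvd_stirlingSeries_pow_mul_sub p (e + j) b)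
  have h₂ := (pow_dvd_pow (p : ℤ⟦X⟧) e.le_succ).trans
    (dvd_pow_sub_expand_pow p (stirlingSeries p ^ b) j e)
  simpa using dvd_add h₁ h₂

theorem dvd_stirlingSecond_of_not_dvd (p : ℕ) [hp : Fact p.Prime] (b j e n : ℕ)
    (hn : ¬ p ^ j ∣ n) :
    (p : ℤ) ^ e ∣ Nat.stirlingSecond n (p ^ (e + j + 1) * b) := by
  set k := p ^ (e + j + 1) * b with hk
  rcases lt_or_ge n k with h | h
  · simp [Nat.stirlingSecond_eq_zero_of_lt h]
  · obtain ⟨m, rfl⟩ := Nat.exists_eq_add_of_le' h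
    have hjk : p ^ j ∣ k := (pow_dvd_pow p (by omega)).mul_right b
    have hm : ¬ p ^ j ∣ m := fun hm => hn (hm.add hjk)
    have := dvd_coeff_of_dvd (dvd_stirlingSeries_sub_expand p b j e) m
    rwa [map_sub, coeff_expand_of_not_dvd _ _ _ hm, sub_zero, coeff_stirlingSeries] at this

theorem dvd_stirlingSecond_sub (p : ℕ) [hp : Fact p.Prime] (b m e : ℕ) :
    (p : ℤ) ^ e ∣ (Nat.stirlingSecond (p ^ (e + 2) * (m + b)) (p ^ (e + 2) * b) : ℤ) -
      Nat.stirlingSecond (p ^ (e + 1) * (m + b)) (p ^ (e + 1) * b) := by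
  have h₁ := dvd_coeff_of_dvd (dvd_stirlingSeries_sub_expand p b 1 e) (p ^ (e + 2) * m)
  have h₂ := dvd_coeff_of_dvd (dvd_stirlingSeries_pow_mul_sub p e b) (p ^ (e + 1) * m)
  rw [map_sub, coeff_stirlingSeries, ← mul_add] at h₁ h₂
  rw [show p ^ (e + 2) * m = p ^ 1 * (p ^ (e + 1) * m) by ring, coeff_expand_mul] at h₁
  simpa using dvd_sub h₁ h₂

end

section

open Filter Topology

variable {p : ℕ} [hp : Fact p.Prime]

theorem norm_intCast_le_of_pow_dvd {e : ℕ} {x : ℤ} (h : (p : ℤ) ^ e ∣ x) :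
    ‖(x : ℤ_[p])‖ ≤ ((p : ℝ)⁻¹) ^ e := by
  rw [inv_pow, ← zpow_natCast, ← zpow_neg]
  exact (PadicInt.norm_int_le_pow_iff_dvd).mpr (by exact_mod_cast h)

theorem tendsto_intCast_zero_of_pow_dvd {f : ℕ → ℤ} (N : ℕ)
    (h : ∀ e, (p : ℤ) ^ e ∣ f (e + N)) :
    Tendsto (fun e => (f e : ℤ_[p])) atTop (𝓝 0) := by
  rw [← tendsto_add_atTop_iff_nat N]
  refine squeeze_zero_norm (fun e => norm_intCast_le_of_pow_dvd (h e)) ?_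
  exact tendsto_pow_atTop_nhds_zero_of_lt_one (by positivity)
    (inv_lt_one_of_one_lt₀ (by exact_mod_cast hp.out.one_lt))

theorem exists_tendsto_intCast_of_pow_dvd {f : ℕ → ℤ} (N : ℕ)
    (h : ∀ e, (p : ℤ) ^ e ∣ f (e + 1 + N) - f (e + N)) :
    ∃ L : ℤ_[p], Tendsto (fun e => (f e : ℤ_[p])) atTop (𝓝 L) := by
  have hc : CauchySeq fun e => (f (e + N) : ℤ_[p]) := by
    refine cauchySeq_of_le_geometric (p : ℝ)⁻¹ 1
      (inv_lt_one_of_one_lt₀ (by exact_mod_cast hp.out.one_lt)) fun e => ?_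
    rw [one_mul, dist_comm, dist_eq_norm, ← Int.cast_sub]
    exact norm_intCast_le_of_pow_dvd (h e)
  obtain ⟨L, hL⟩ := cauchySeq_tendsto_of_complete hc
  exact ⟨L, (tendsto_add_atTop_iff_nat N).mp hL⟩

theorem exists_tendsto_stirling2 (a b : ℤ) (hb : 1 ≤ b) (hba : b ≤ a) :
    ∃ L : ℤ_[p], Tendsto (fun e : ℕ =>
      ((stirling2 ((p : ℤ) ^ e * a) ((p : ℤ) ^ e * b) : ℤ) : ℤ_[p])) atTop (𝓝 L) := by
  lift b to ℕ using by omega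
  obtain ⟨m, rfl⟩ : ∃ m : ℕ, a = m + b := ⟨(a - b).toNat, by omega⟩
  refine exists_tendsto_intCast_of_pow_dvd 1 fun e => ?_
  have h := dvd_stirlingSecond_sub p b m e
  rw [← stirling2_natCast, ← stirling2_natCast] at h
  push_cast at h
  exact h

theorem tendsto_stirling2_sub_zero (a b c : ℤ) (hb : 1 ≤ b) (hc : c ≠ 0) :
    Tendsto (fun e : ℕ =>
      ((stirling2 ((p : ℤ) ^ e * a - c) ((p : ℤ) ^ e * b) : ℤ) : ℤ_[p])) atTop (𝓝 0) := by
  lift b to ℕ using by omega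
  set j := c.natAbs
  have hj : ¬ (p : ℤ) ^ j ∣ c := fun h => by
    have h₁ := Int.natAbs_dvd_natAbs.mpr h
    rw [Int.natAbs_pow, Int.natAbs_natCast] at h₁
    exact (Nat.le_of_dvd (Int.natAbs_pos.mpr hc) h₁).not_gt (Nat.lt_pow_self hp.out.one_lt)
  refine tendsto_intCast_zero_of_pow_dvd (j + 1) fun e => ?_
  rcases lt_or_ge ((p : ℤ) ^ (e + (j + 1)) * a - c) 0 with hn | hn
  · simp [stirling2, hn]
  · obtain ⟨n, hn⟩ := Int.eq_ofNat_of_zero_le hn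
    have hjn : ¬ p ^ j ∣ n := fun h => hj <| by
      have h₁ : (p : ℤ) ^ j ∣ n := by exact_mod_cast h
      rw [← hn] at h₁
      exact (dvd_sub_right ((pow_dvd_pow (p : ℤ) (by omega)).mul_right a)).mp h₁
    have h := dvd_stirlingSecond_of_not_dvd p b j e n hjn
    rw [← stirling2_natCast] at h
    push_cast at h
    rwa [hn]

theorem tendsto_stirling2_sub_sub {a b : ℤ} (ha : 1 ≤ a) (hb : 1 ≤ b) {L : ℤ_[p]}
    (hL : Tendsto (fun e : ℕ =>
      ((stirling2 ((p : ℤ) ^ e * a) ((p : ℤ) ^ e * b) : ℤ) : ℤ_[p])) atTop (𝓝 L))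
    (d : ℕ) (c : ℤ) :
    Tendsto (fun e : ℕ =>
      ((stirling2 ((p : ℤ) ^ e * a - c) ((p : ℤ) ^ e * b - d) : ℤ) : ℤ_[p])) atTop
      (𝓝 ((stirling1Abs d c : ℤ_[p]) * L)) := by
  induction d generalizing c with
  | zero =>
    rcases eq_or_ne c 0 with rfl | hc
    · simpa [stirling1Abs] using hL
    · simpa [stirling1Abs, hc] using tendsto_stirling2_sub_zero a b c hb hc
  | succ d ih =>
    have hk : Tendsto (fun e : ℕ => (((p : ℤ) ^ e * b - d : ℤ) : ℤ_[p])) atTop (𝓝 (-d)) := by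
      have h : Tendsto (fun e : ℕ => (((p : ℤ) ^ e * b : ℤ) : ℤ_[p])) atTop (𝓝 0) :=
        tendsto_intCast_zero_of_pow_dvd 0 fun e => dvd_mul_right _ _
      simpa using h.sub_const (d : ℤ_[p])
    have hlim := (ih (c - 1)).sub (hk.mul (ih c))
    have hval : (stirling1Abs d (c - 1) : ℤ_[p]) * L - -(d : ℤ_[p]) * (stirling1Abs d c * L) =
        (stirling1Abs (d + 1) c : ℤ_[p]) * L := by
      rw [stirling1Abs_succ]
      push_cast
      ring
    rw [hval] at hlim
    refine hlim.congr' ?_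
    filter_upwards [eventually_ge_atTop (c.natAbs + d)] with e he
    have hpe : (e : ℤ) < (p : ℤ) ^ e := by exact_mod_cast Nat.lt_pow_self hp.out.one_lt
    have hea : (p : ℤ) ^ e ≤ (p : ℤ) ^ e * a := le_mul_of_one_le_right (by positivity) ha
    have heb : (p : ℤ) ^ e ≤ (p : ℤ) ^ e * b := le_mul_of_one_le_right (by positivity) hb
    rw [stirling2_eq_add ((p : ℤ) ^ e * a - (c - 1)) _ (by omega) (by omega),
      show (p : ℤ) ^ e * a - (c - 1) - 1 = (p : ℤ) ^ e * a - c by ring,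
      show (p : ℤ) ^ e * b - d - 1 = (p : ℤ) ^ e * b - (d + 1 : ℕ) by push_cast; ring]
    push_cast
    ring

end

theorem padic_limit_stirling2_neg_neg (p : ℕ) [Fact p.Prime] (a b c d : ℤ)
    (hb : 1 ≤ b) (hba : b ≤ a) (hc : c < 0) (hd : d < 0) :
    ∃ L : ℤ_[p],
      Filter.Tendsto
        (fun e : ℕ => ((stirling2 ((p : ℤ) ^ e * a) ((p : ℤ) ^ e * b) : ℤ) : ℤ_[p]))
        Filter.atTop (nhds L) ∧
      Filter.Tendsto
        (fun e : ℕ => ((stirling2 ((p : ℤ) ^ e * a + c) ((p : ℤ) ^ e * b + d) : ℤ) : ℤ_[p]))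
        Filter.atTop (nhds (((stirling1Abs (-d).toNat (-c) : ℤ) : ℤ_[p]) * L)) := by
  obtain ⟨L, hL⟩ := exists_tendsto_stirling2 (p := p) a b hb hba
  refine ⟨L, hL, ?_⟩
  have h := tendsto_stirling2_sub_sub (hb.trans hba) hb hL (-d).toNat (-c)
  have hdn : (((-d).toNat : ℕ) : ℤ) = -d := Int.toNat_of_nonneg (by omega)
  simpa only [hdn, sub_neg_eq_add] using h
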